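/- Let G be a finite simple group, c₁ : X₁ → G a surjective cellular cover of G, and c₂ : X₂ → X₁ a surjective cellular cover of X₁. Then the composition c₁ ∘ c₂ : X₂ → G is a (surjective) cellular cover of G. -/

import Mathlib

/-- Homomorphisms to `ZMod p` separate points of an abelian group of exponent `p`. -/
theorem exists_addMonoidHom_zmod_ne_zero {B : Type*} [AddCommGroup B] {p : ℕ} [Fact p.Prime]
    (hB : ∀ b : B, p • b = 0) {b : B} (hb : b ≠ 0) : ∃ ℓ : B →+ ZMod p, ℓ b ≠ 0 := by
  have : Module (ZMod p) B := AddCommGroup.zmodModule hB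
  obtain ⟨ℓ, hℓ⟩ := Module.Projective.exists_dual_ne_zero (ZMod p) hb
  exact ⟨ℓ.toAddMonoidHom, hℓ⟩

/-- A bounded abelian group with no nonzero homomorphisms into an abelian group mapping onto it
is trivial. -/
theorem subsingleton_of_addMonoidHom_eq_zero {A K : Type*} [AddCommGroup A] [AddCommGroup K]
    (π : K →+ A) (hπ : Function.Surjective π) {n : ℕ} (hn : n ≠ 0) (hK : ∀ k : K, n • k = 0)
    (hAK : ∀ f : A →+ K, f = 0) : Subsingleton A := by
  have div : ∀ p : ℕ, p.Prime → ∀ a : A, ∃ b : A, p • b = a := by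
    intro p hp
    by_contra! ⟨a, ha⟩
    have : Fact p.Prime := ⟨hp⟩
    let H : AddSubgroup A := (nsmulAddMonoidHom p : A →+ A).range
    have hH : ∀ b : A ⧸ H, p • b = 0 := by
      intro b
      obtain ⟨x, rfl⟩ := QuotientAddGroup.mk_surjective b
      exact (QuotientAddGroup.eq_zero_iff _).2 ⟨x, rfl⟩
    have haH : (QuotientAddGroup.mk a : A ⧸ H) ≠ 0 := by
      rw [Ne, QuotientAddGroup.eq_zero_iff]
      rintro ⟨b, hb⟩
      exact ha b hb
    obtain ⟨ℓ, hℓ⟩ := exists_addMonoidHom_zmod_ne_zero hH haH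
    have torsion_free : ∀ k : K, p • k = 0 → k = 0 := by
      intro k hk
      let j : ZMod p →+ K := ZMod.lift p ⟨zmultiplesHom K k, by simpa using hk⟩
      have hj : j (ℓ (QuotientAddGroup.mk a)) = 0 :=
        DFunLike.congr_fun (hAK ((j.comp ℓ).comp (QuotientAddGroup.mk' H))) a
      have hr := ZMod.natCast_zmod_val (ℓ (QuotientAddGroup.mk a))
      set r := (ℓ (QuotientAddGroup.mk a)).val
      have hrk : r • k = 0 := by
        rw [← hr] at hj
        have := ZMod.lift_coe p ⟨zmultiplesHom K k, by simpa using hk⟩ (r : ℤ)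
        simpa [j] using this.symm.trans (by simpa [j] using hj)
      have hcop : Nat.Coprime p r := by
        rw [hp.coprime_iff_not_dvd, ← ZMod.natCast_eq_zero_iff, hr]
        exact hℓ
      have : addOrderOf k ∣ 1 := by
        rw [← hcop.gcd_eq_one]
        exact Nat.dvd_gcd (addOrderOf_dvd_of_nsmul_eq_zero hk) (addOrderOf_dvd_of_nsmul_eq_zero hrk)
      simpa using this
    obtain ⟨k, rfl⟩ := hπ a
    obtain ⟨e, m, hm, rfl⟩ := Nat.exists_eq_pow_mul_and_not_dvd hn p hp.ne_one
    have hmk : m • k = 0 := by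
      have key : ∀ (e : ℕ) (x : K), p ^ e • x = 0 → x = 0 := by
        intro e
        induction e with
        | zero => intro x hx; simpa using hx
        | succ e ih =>
          intro x hx
          exact ih x (torsion_free _ (by rw [← mul_nsmul', ← pow_succ']; exact hx))
      exact key e _ (by rw [← mul_nsmul']; exact hK k)
    have hbez := Nat.gcd_eq_gcd_ab p m
    rw [(hp.coprime_iff_not_dvd.2 hm).gcd_eq_one] at hbez
    have hk : (p : ℤ) • (p.gcdA m • k) = k := by
      have := congrArg (fun z : ℤ => z • k) hbez
      simp only [Nat.cast_one, one_smul, add_smul, mul_smul] at this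
      rw [smul_comm (m : ℤ), natCast_zsmul k m, hmk, smul_zero, add_zero] at this
      exact this.symm
    refine ha (π (p.gcdA m • k)) ?_
    rw [← map_nsmul, ← natCast_zsmul, hk]
  have divAll : ∀ m : ℕ, m ≠ 0 → ∀ a : A, ∃ b : A, m • b = a := by
    intro m
    induction m using Nat.recOnMul with
    | zero => intro h; exact absurd rfl h
    | one => intro _ a; exact ⟨a, one_nsmul a⟩
    | prime p hp => intro _; exact div p hp
    | mul x y hx hy =>
      intro hxy a
      obtain ⟨b, rfl⟩ := hx (left_ne_zero_of_mul hxy) a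
      obtain ⟨c, rfl⟩ := hy (right_ne_zero_of_mul hxy) b
      exact ⟨c, mul_nsmul' c x y⟩
  refine subsingleton_of_forall_eq 0 fun a => ?_
  obtain ⟨b, rfl⟩ := divAll n hn a
  obtain ⟨k, rfl⟩ := hπ b
  rw [← map_nsmul, hK, map_zero]

section CellularCover

open scoped commutatorElement

variable {X Q : Type*} [Group X] [Group Q] (c : X →* Q)

theorem mem_center_of_injective_comp
    (h : Function.Injective fun f : X →* X => c.comp f) {l : X}
    (hl : c l ∈ Subgroup.center Q) : l ∈ Subgroup.center X := by
  have hconj : (MulAut.conj l).toMonoidHom = MonoidHom.id X := h <| by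
    ext x
    simp [← Subgroup.mem_center_iff.1 hl (c x)]
  refine Subgroup.mem_center_iff.2 fun x => ?_
  have := DFunLike.congr_fun hconj x
  simp only [MulEquiv.coe_toMonoidHom, MulAut.conj_apply, MonoidHom.id_apply] at this
  exact (mul_inv_eq_iff_eq_mul.1 this).symm

theorem ker_le_center_of_injective_comp
    (h : Function.Injective fun f : X →* X => c.comp f) : c.ker ≤ Subgroup.center X :=
  fun l hl => mem_center_of_injective_comp c h (by rw [MonoidHom.mem_ker.1 hl]; exact one_mem _)

theorem eq_one_of_injective_comp
    (h : Function.Injective fun f : X →* X => c.comp f) (f : X →* X) (hf : ∀ x, c (f x) = 1) :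
    f = 1 :=
  h <| by ext x; simp [hf]

/-- A central extension of a finite group has finitely many commutators. -/
theorem finite_commutatorSet_of_ker_le_center [Finite Q] (h : c.ker ≤ Subgroup.center X) :
    Finite (commutatorSet X) := by
  have key : ∀ a b a' b' : X, c a = c a' → c b = c b' → ⁅a, b⁆ = ⁅a', b'⁆ := by
    intro a b a' b' ha hb
    have hu := Subgroup.mem_center_iff.1 (h (c.eq_iff.1 ha))
    have hv := Subgroup.mem_center_iff.1 (h (c.eq_iff.1 hb))
    obtain ⟨u, rfl⟩ : ∃ u, a = a' * u := ⟨a'⁻¹ * a, by group⟩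
    obtain ⟨v, rfl⟩ : ∃ v, b = b' * v := ⟨b'⁻¹ * b, by group⟩
    simp only [inv_mul_cancel_left] at hu hv
    rw [commutatorElement_def, commutatorElement_def]
    calc a' * u * (b' * v) * (a' * u)⁻¹ * (b' * v)⁻¹
        = a' * (u * (b' * v * u⁻¹)) * a'⁻¹ * (v⁻¹ * b'⁻¹) := by group
      _ = a' * (b' * (v * a'⁻¹)) * (v⁻¹ * b'⁻¹) := by rw [← hu]; group
      _ = a' * b' * a'⁻¹ * b'⁻¹ := by rw [← hv]; group
  choose s hs using fun q : c.range => q.2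
  refine Set.Finite.to_subtype <|
    (Set.finite_range fun q : c.range × c.range => ⁅s q.1, s q.2⁆).subset ?_
  rintro _ ⟨a, b, rfl⟩
  exact ⟨(⟨c a, a, rfl⟩, ⟨c b, b, rfl⟩), key _ _ _ _ (hs _) (hs _)⟩

/-- If homomorphisms `f` and `g` out of a perfect group agree modulo the center, they are equal. -/
theorem MonoidHom.eq_of_div_mem_center {Y : Type*} [Group Y] (hX : commutator X = ⊤)
    (f g : X →* Y) (h : ∀ x, f x * (g x)⁻¹ ∈ Subgroup.center Y) : f = g := by
  let q : X →* Subgroup.center Y := MonoidHom.mk' (fun x => ⟨f x * (g x)⁻¹, h x⟩) fun x y => by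
    ext
    have := Subgroup.mem_center_iff.1 (h y) (f x)
    have h' := Subgroup.mem_center_iff.1 (h y) (g x)⁻¹
    simp only [map_mul, mul_inv_rev, Subgroup.coe_mul]
    rw [mul_assoc (f x) (g x)⁻¹, h']
    group
  ext x
  have hq : commutator X ≤ q.ker := by
    refine Subgroup.commutator_le.2 fun a _ b _ => ?_
    rw [MonoidHom.mem_ker, map_commutatorElement, commutatorElement_eq_one_iff_mul_comm]
    exact Subtype.ext (Subgroup.mem_center_iff.1 (q b).2 (q a))
  have hx : x ∈ q.ker := hq (hX ▸ Subgroup.mem_top x)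
  exact mul_inv_eq_one.1 (congrArg Subtype.val (MonoidHom.mem_ker.1 hx))

/-- A surjective cellular cover of a finite perfect group is perfect. -/
theorem commutator_eq_top_of_cellularCover [Finite Q] (hQ : commutator Q = ⊤)
    (hs : Function.Surjective c) (h : Function.Injective fun f : X →* X => c.comp f) :
    commutator X = ⊤ := by
  have hker := ker_le_center_of_injective_comp c h
  have hidx : c.ker.index ≠ 0 := by
    rw [Subgroup.index_ker]
    exact Nat.card_pos.ne'
  have hfin : (Subgroup.center X).FiniteIndex :=
    ⟨ne_zero_of_dvd_ne_zero hidx (Subgroup.index_dvd_of_le hker)⟩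
  have hpow : ∀ x : X, x ^ ((Subgroup.center X).index * Nat.card Q) = 1 := by
    have hmul : ∀ x y : X, (x * y) ^ ((Subgroup.center X).index * Nat.card Q) =
        x ^ ((Subgroup.center X).index * Nat.card Q) *
          y ^ ((Subgroup.center X).index * Nat.card Q) := by
      intro x y
      have hxy := congrArg Subtype.val (map_mul (MonoidHom.transferCenterPow X) x y)
      simp only [Subgroup.coe_mul, MonoidHom.transferCenterPow_apply] at hxy
      have hcomm : Commute (x ^ (Subgroup.center X).index) (y ^ (Subgroup.center X).index) :=
        Subgroup.mem_center_iff.1 ((Subgroup.center X).pow_index_mem y) _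
      rw [pow_mul, hxy, hcomm.mul_pow, pow_mul, pow_mul]
    let f : X →* X := MonoidHom.mk' (fun x => x ^ ((Subgroup.center X).index * Nat.card Q)) hmul
    exact DFunLike.congr_fun <| eq_one_of_injective_comp c h f fun x =>
      (map_pow c _ _).trans (by rw [pow_mul, pow_card_eq_one'])
  let : CommGroup c.ker :=
    { (inferInstance : Group c.ker) with
      mul_comm := fun a b => Subtype.ext (Subgroup.mem_center_iff.1 (hker b.2) a) }
  let π : c.ker →* Abelianization X := Abelianization.of.comp c.ker.subtype
  have hπ : Function.Surjective π := by
    intro a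
    obtain ⟨x, rfl⟩ := QuotientGroup.mk_surjective a
    have hx : c x ∈ (commutator X).map c := by
      rw [commutator_def, Subgroup.map_commutator, Subgroup.map_top_of_surjective c hs,
        ← commutator_def, hQ]
      exact Subgroup.mem_top _
    obtain ⟨y, hy, hyx⟩ := hx
    refine ⟨⟨y⁻¹ * x, c.eq_iff.1 hyx.symm⟩, ?_⟩
    have : (Abelianization.of y : Abelianization X) = 1 := (QuotientGroup.eq_one_iff y).2 hy
    change Abelianization.of (y⁻¹ * x) = Abelianization.of x
    rw [map_mul, map_inv, this, inv_one, one_mul]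
  have hsub : Subsingleton (Additive (Abelianization X)) := by
    refine subsingleton_of_addMonoidHom_eq_zero (K := Additive c.ker) (MonoidHom.toAdditive π) hπ
      (mul_ne_zero hfin.index_ne_zero (Nat.card_pos (α := Q)).ne')
      (fun k => Subtype.ext (hpow k.toMul.1)) fun f => ?_
    let g : Abelianization X →* c.ker := MonoidHom.toAdditive.symm f
    have hg := eq_one_of_injective_comp c h (c.ker.subtype.comp (g.comp Abelianization.of))
      fun x => (g (Abelianization.of x)).2
    ext a
    exact DFunLike.congr_fun hg a
  refine (Subgroup.eq_top_iff' _).2 fun x => (QuotientGroup.eq_one_iff x).1 ?_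
  exact hsub.elim (Additive.ofMul (Abelianization.of x)) 0

/-- A surjective cellular cover of a finite simple abelian group is injective. -/
theorem injective_of_cellularCover_of_isMulCommutative [Finite Q] [IsSimpleGroup Q]
    (hQ : IsMulCommutative Q) (hs : Function.Surjective c)
    (h : Function.Injective fun f : X →* X => c.comp f) : Function.Injective c := by
  let : CommGroup Q := { (inferInstance : Group Q) with mul_comm := hQ.is_comm.comm }
  have : IsCyclic Q := IsSimpleGroup.isCyclic
  have hX := c.isMulCommutative_of_isCyclic_of_ker_le_center (ker_le_center_of_injective_comp c h)
  let : CommGroup X := { (inferInstance : Group X) with mul_comm := hX.is_comm.comm }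
  have hpow : ∀ x : X, x ^ Nat.card Q = 1 := DFunLike.congr_fun
    (eq_one_of_injective_comp c h (powMonoidHom (Nat.card Q)) fun x => by simp)
  obtain ⟨g, hg⟩ := IsCyclic.exists_generator (α := Q)
  obtain ⟨x, rfl⟩ := hs g
  refine (injective_iff_map_eq_one c).2 fun k hk => ?_
  have hord : orderOf k ∣ orderOf (c x) := by
    rw [orderOf_eq_card_of_forall_mem_zpowers hg]
    exact orderOf_dvd_of_pow_eq_one (hpow k)
  let j : Q →* X := monoidHomOfForallMemZpowers hg hord
  have hj : j (c x) = k := monoidHomOfForallMemZpowers_apply_gen hg hord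
  have hck : ∀ q, c (j q) = 1 := by
    intro q
    obtain ⟨m, rfl⟩ := hg q
    simp [hj, hk]
  rw [← hj]
  exact DFunLike.congr_fun (eq_one_of_injective_comp c h (j.comp c) fun y => hck _) x

/-- A homomorphism from a perfect central extension of a finite simple group to that group is
trivial or factors through the extension. -/
theorem MonoidHom.eq_one_or_exists_comp_eq [Finite Q] [IsSimpleGroup Q]
    (hX : commutator X = ⊤) (hs : Function.Surjective c) (hker : c.ker ≤ Subgroup.center X)
    (φ : X →* Q) : φ = 1 ∨ ∃ α : Q →* Q, α.comp c = φ := by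
  have hn : (φ.ker.map c).Normal := φ.normal_ker.map c hs
  rcases hn.eq_bot_or_eq_top with hbot | htop
  · right
    have hle : φ.ker ≤ c.ker := (Subgroup.map_eq_bot_iff _).1 hbot
    have hindex : φ.ker.index ≤ c.ker.index := by
      rw [Subgroup.index_ker, Subgroup.index_ker, MonoidHom.range_eq_top.2 hs, Subgroup.card_top]
      exact Subgroup.card_le_card_group _
    have hpos : 0 < φ.ker.index := by
      rw [Subgroup.index_ker]
      exact Nat.card_pos
    have hmul := Subgroup.relIndex_mul_index hle
    have hone : φ.ker.relIndex c.ker = 1 := by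
      rw [← hmul] at hindex hpos
      have h₁ := Nat.pos_of_mul_pos_left hpos
      have h₂ := Nat.pos_of_mul_pos_right hpos
      nlinarith
    exact ⟨c.liftOfSurjective hs ⟨φ, Subgroup.relIndex_eq_one.1 hone⟩,
      MonoidHom.liftOfRightInverse_comp _ _ _ _⟩
  · left
    have key : ∀ y, ∃ z ∈ Subgroup.center X, φ z = φ y := by
      intro y
      obtain ⟨n, hn, hny⟩ : c y ∈ φ.ker.map c := htop ▸ Subgroup.mem_top _
      refine ⟨n⁻¹ * y, hker (c.eq_iff.1 hny.symm), ?_⟩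
      rw [map_mul, map_inv, MonoidHom.mem_ker.1 hn, inv_one, one_mul]
    have hcomm : commutator X ≤ φ.ker := by
      refine Subgroup.commutator_le.2 fun a _ b _ => ?_
      obtain ⟨z, hz, hza⟩ := key a
      rw [MonoidHom.mem_ker, map_commutatorElement, commutatorElement_eq_one_iff_mul_comm, ← hza,
        ← map_mul, ← map_mul, Subgroup.mem_center_iff.1 hz b]
    ext x
    exact hcomm (hX ▸ Subgroup.mem_top x)

end CellularCover

/-- Let `G` be a finite simple group, `c₁ : X₁ → G` a surjective
cellular cover of `G`, and `c₂ : X₂ → X₁` a surjective cellular cover of `X₁`. Then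
the composition `c₁ ∘ c₂ : X₂ → G` is a (surjective) cellular cover of `G`. -/
theorem stmt19 {G X₁ X₂ : Type*} [Group G] [Group X₁] [Group X₂]
    [Finite G] [IsSimpleGroup G]
    (c₁ : X₁ →* G) (h₁s : Function.Surjective c₁)
    (h₁ : Function.Bijective (fun f : X₁ →* X₁ => c₁.comp f))
    (c₂ : X₂ →* X₁) (h₂s : Function.Surjective c₂)
    (h₂ : Function.Bijective (fun f : X₂ →* X₂ => c₂.comp f)) :
    Function.Surjective (c₁.comp c₂) ∧
      Function.Bijective (fun f : X₂ →* X₂ => (c₁.comp c₂).comp f) := by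
  refine ⟨h₁s.comp h₂s, ?_⟩
  have hcenter : (c₁.comp c₂).ker ≤ Subgroup.center X₂ := fun l hl =>
    mem_center_of_injective_comp c₂ h₂.1 (ker_le_center_of_injective_comp c₁ h₁.1 hl)
  rcases (inferInstance : (commutator G).Normal).eq_bot_or_eq_top with hG | hG
  · have hcomm : IsMulCommutative G :=
      Subgroup.center_eq_top_iff.1 ((commutator_eq_bot_iff_center_eq_top G).1 hG)
    have hinj := injective_of_cellularCover_of_isMulCommutative c₁ hcomm h₁s h₁.1
    let e := MulEquiv.ofBijective c₁ ⟨hinj, h₁s⟩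
    refine ⟨fun f g hfg => h₂.1 ?_, fun φ => ?_⟩
    · ext x
      exact hinj (DFunLike.congr_fun hfg x)
    · obtain ⟨f, hf⟩ := h₂.2 (e.symm.toMonoidHom.comp φ)
      refine ⟨f, ?_⟩
      ext x
      exact (congrArg c₁ (DFunLike.congr_fun hf x)).trans (e.apply_symm_apply (φ x))
  · have hX₁ := commutator_eq_top_of_cellularCover c₁ hG h₁s h₁.1
    have : Finite (commutatorSet X₁) :=
      finite_commutatorSet_of_ker_le_center c₁ (ker_le_center_of_injective_comp c₁ h₁.1)
    have : Finite X₁ := by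
      have : Finite (commutator X₁) := inferInstance
      rw [hX₁] at this
      exact Finite.of_equiv _ Subgroup.topEquiv.toEquiv
    have hX₂ := commutator_eq_top_of_cellularCover c₂ hX₁ h₂s h₂.1
    refine ⟨fun f g hfg => MonoidHom.eq_of_div_mem_center hX₂ f g fun x => hcenter ?_, fun φ => ?_⟩
    · have := DFunLike.congr_fun hfg x
      rw [MonoidHom.mem_ker, map_mul, map_inv, mul_inv_eq_one]
      exact this
    · rcases MonoidHom.eq_one_or_exists_comp_eq (c₁.comp c₂) hX₂ (h₁s.comp h₂s) hcenter φ with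
        rfl | ⟨α, rfl⟩
      · exact ⟨1, by ext x; simp⟩
      · obtain ⟨β, hβ⟩ := h₁.2 (α.comp c₁)
        obtain ⟨γ, hγ⟩ := h₂.2 (β.comp c₂)
        refine ⟨γ, ?_⟩
        ext x
        exact (congrArg c₁ (DFunLike.congr_fun hγ x)).trans (DFunLike.congr_fun hβ (c₂ x))
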